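/- Let π be a μ-projective unitary representation of a countable discrete group G on a complex separable Hilbert space H such that the set B_π of Bessel vectors of π is dense in H, and let x, y ∈ H. Then x and y are π-weakly equivalent (the closures in ℓ²(G) of the ranges of the analysis operators Θ_x and Θ_y coincide) if and only if [π(G)'x] = [π(G)'y]. -/

import Mathlib

open scoped InnerProductSpace

noncomputable section

variable {G : Type*} {H : Type*} [NormedAddCommGroup H] [InnerProductSpace ℂ H]

/-- `π` is a projective unitary representation of `G` on `H` with multiplier `mu`:
each `π g` is a unitary operator (a surjective linear isometry) and
`π g ∘ π h = mu g h • π (g * h)`, where `|mu g h| = 1`. -/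
def IsProjUnitaryRep [Group G] (mu : G → G → ℂ) (π : G → H →L[ℂ] H) : Prop :=
  (∀ g h, ‖mu g h‖ = 1) ∧
  (∀ g, (∀ x : H, ‖π g x‖ = ‖x‖) ∧ Function.Surjective (π g)) ∧
  (∀ g h, (π g).comp (π h) = mu g h • π (g * h))

/-- `π` is a unitary representation of `G` on `H`. -/
def IsUnitaryRep [Group G] (π : G → H →L[ℂ] H) : Prop :=
  (∀ g, (∀ x : H, ‖π g x‖ = ‖x‖) ∧ Function.Surjective (π g)) ∧
  (∀ g h, (π g).comp (π h) = π (g * h))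

/-- `ξ` is a Bessel vector for `π`: `∑_g |⟨x, π g ξ⟩|² ≤ B‖x‖²` for all `x ∈ H`
(expressed via finite partial sums). -/
def IsBesselVector (π : G → H →L[ℂ] H) (ξ : H) : Prop :=
  ∃ B : ℝ, 0 < B ∧ ∀ x : H, ∀ s : Finset G, ∑ g ∈ s, ‖⟪x, π g ξ⟫_ℂ‖ ^ 2 ≤ B * ‖x‖ ^ 2

/-- `{π g ξ}_{g ∈ G}` satisfies the frame inequalities
`A‖x‖² ≤ ∑_g |⟨x, π g ξ⟩|² ≤ B‖x‖²` for all `x` in the set `M`. -/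
def IsFrameOn (π : G → H →L[ℂ] H) (ξ : H) (M : Set H) : Prop :=
  ∃ A B : ℝ, 0 < A ∧ A ≤ B ∧ ∀ x ∈ M,
    Summable (fun g : G => ‖⟪x, π g ξ⟫_ℂ‖ ^ 2) ∧
    A * ‖x‖ ^ 2 ≤ ∑' g : G, ‖⟪x, π g ξ⟫_ℂ‖ ^ 2 ∧
    ∑' g : G, ‖⟪x, π g ξ⟫_ℂ‖ ^ 2 ≤ B * ‖x‖ ^ 2

/-- The closed linear span of the orbit `{π g ξ : g ∈ G}`. -/
def orbitSpan (π : G → H →L[ℂ] H) (ξ : H) : Set H :=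
  closure (Submodule.span ℂ (Set.range fun g : G => π g ξ) : Set H)

/-- `{π g ξ}_{g ∈ G}` is a frame sequence: a frame for its closed linear span. -/
def IsFrameSequence (π : G → H →L[ℂ] H) (ξ : H) : Prop :=
  IsFrameOn π ξ (orbitSpan π ξ)

/-- `ξ` is a complete frame vector for `π`: `{π g ξ}_{g ∈ G}` is a frame for `H`. -/
def IsCompleteFrameVector (π : G → H →L[ℂ] H) (ξ : H) : Prop :=
  IsFrameOn π ξ Set.univ

/-- `{π g ξ}_{g ∈ G}` is a Parseval frame on the set `M`:
`∑_g |⟨x, π g ξ⟩|² = ‖x‖²` for all `x ∈ M`. -/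
def IsParsevalFrameOn (π : G → H →L[ℂ] H) (ξ : H) (M : Set H) : Prop :=
  ∀ x ∈ M, HasSum (fun g : G => ‖⟪x, π g ξ⟫_ℂ‖ ^ 2) (‖x‖ ^ 2)

/-- `{π g η}_{g ∈ G}` is a Riesz sequence:
`A ∑ |c g|² ≤ ‖∑ c g • π g η‖² ≤ B ∑ |c g|²` for all finitely supported `c`. -/
def IsRieszSequence (π : G → H →L[ℂ] H) (η : H) : Prop :=
  ∃ A B : ℝ, 0 < A ∧ A ≤ B ∧ ∀ c : G →₀ ℂ,
    A * ∑ g ∈ c.support, ‖c g‖ ^ 2 ≤ ‖∑ g ∈ c.support, c g • π g η‖ ^ 2 ∧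
    ‖∑ g ∈ c.support, c g • π g η‖ ^ 2 ≤ B * ∑ g ∈ c.support, ‖c g‖ ^ 2

/-- The commutant `S' = {T : T A = A T for all A ∈ S}` of a set `S` of operators. -/
def commutant (S : Set (H →L[ℂ] H)) : Set (H →L[ℂ] H) := Set.centralizer S

/-- `(π, σ)` is a commuting pair: `π(G)' = σ(G)''`. -/
def IsCommutingPair (π σ : G → H →L[ℂ] H) : Prop :=
  commutant (Set.range π) = commutant (commutant (Set.range σ))

end

section SquareSummable

open scoped ComplexConjugate

variable {G : Type*}

/-- Pulling back along a permutation and multiplying by unimodular scalars acts on `ℓ²(G)`. -/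
theorem exists_lp_two_reindex (c : G → ℂ) (hc : ∀ g, ‖c g‖ = 1) (e : G ≃ G)
    (F : lp (fun _ : G => ℂ) 2) :
    ∃ F' : lp (fun _ : G => ℂ) 2, ∀ g, F' g = c g * F (e g) := by
  have hF : Memℓp (fun g => c g * F (e g)) 2 := by
    have h := (memℓp_gen_iff (by norm_num)).1 (lp.memℓp F)
    refine memℓp_gen ?_
    simpa [hc, Function.comp_def] using (e.summable_iff).2 h
  exact ⟨⟨_, hF⟩, fun _ => rfl⟩

theorem inner_lp_two_reindex {c : G → ℂ} (hc : ∀ g, ‖c g‖ = 1) (e : G ≃ G)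
    {F F' K K' : lp (fun _ : G => ℂ) 2} (hF : ∀ g, F' g = c g * F (e g))
    (hK : ∀ g, K' g = c g * K (e g)) : ⟪F', K'⟫_ℂ = ⟪F, K⟫_ℂ := by
  rw [lp.inner_eq_tsum, lp.inner_eq_tsum, ← e.tsum_eq (fun g => ⟪F g, K g⟫_ℂ)]
  refine tsum_congr fun g => ?_
  have h1 : conj (c g) * c g = 1 := by
    rw [mul_comm, Complex.mul_conj, Complex.normSq_eq_norm_sq, hc]; norm_num
  simp only [hF, hK, RCLike.inner_apply, map_mul]
  linear_combination (K (e g) * conj (F (e g))) * h1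

theorem inner_star_lp_two (F K : lp (fun _ : G => ℂ) 2) : ⟪star F, star K⟫_ℂ = ⟪K, F⟫_ℂ := by
  rw [lp.inner_eq_tsum, lp.inner_eq_tsum]
  exact tsum_congr fun g => by simp [mul_comm]

theorem sum_norm_sq_le_lp_two (F : lp (fun _ : G => ℂ) 2) (s : Finset G) :
    ∑ g ∈ s, ‖F g‖ ^ 2 ≤ ‖F‖ ^ 2 := by
  simpa using lp.sum_rpow_le_norm_rpow (by norm_num) F s

variable {H : Type*} [NormedAddCommGroup H] [InnerProductSpace ℂ H]

/-- A semilinear family of coefficient functionals with uniformly bounded partial square sums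
assembles to a bounded operator into `ℓ²(G)`. -/
theorem exists_continuousLinearMap_lp_two {σ : ℂ →+* ℂ} (f : G → H →ₛₗ[σ] ℂ) (B : ℝ)
    (hB : ∀ a : H, ∀ s : Finset G, ∑ g ∈ s, ‖f g a‖ ^ 2 ≤ B * ‖a‖ ^ 2) :
    ∃ A : H →SL[σ] lp (fun _ : G => ℂ) 2, ∀ a g, A a g = f g a := by
  have hmem (a : H) : Memℓp (fun g => f g a) 2 :=
    memℓp_gen' (C := B * ‖a‖ ^ 2) fun s => by simpa using hB a s
  let L : H →ₛₗ[σ] lp (fun _ : G => ℂ) 2 :=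
    { toFun := fun a => ⟨fun g => f g a, hmem a⟩
      map_add' := fun a b => lp.ext (funext fun g => map_add (f g) a b)
      map_smul' := fun r a => lp.ext (funext fun g => map_smulₛₗ (f g) r a) }
  have hL (a : H) : ‖L a‖ ≤ Real.sqrt |B| * ‖a‖ := by
    refine lp.norm_le_of_forall_sum_le (by norm_num) (by positivity) fun s => ?_
    have : (Real.sqrt |B| * ‖a‖) ^ 2 = |B| * ‖a‖ ^ 2 := by
      rw [mul_pow, Real.sq_sqrt (abs_nonneg B)]
    simpa [L, this] using (hB a s).trans (by gcongr; exact le_abs_self B)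
  exact ⟨L.mkContinuous _ hL, fun _ _ => rfl⟩

end SquareSummable

namespace IsProjUnitaryRep

open scoped ComplexConjugate

variable {G : Type*} [Group G] {H : Type*} [NormedAddCommGroup H] [InnerProductSpace ℂ H]
  {mu : G → G → ℂ} {π : G → H →L[ℂ] H}

theorem inner_map_map (hπ : IsProjUnitaryRep mu π) (g : G) (u v : H) :
    ⟪π g u, π g v⟫_ℂ = ⟪u, v⟫_ℂ :=
  (LinearIsometry.mk (π g).toLinearMap (hπ.2.1 g).1).inner_map_map u v

theorem map_map (hπ : IsProjUnitaryRep mu π) (g h : G) (v : H) :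
    π g (π h v) = mu g h • π (g * h) v := by
  simpa using congrArg (fun T : H →L[ℂ] H => T v) (hπ.2.2 g h)

theorem map_one (hπ : IsProjUnitaryRep mu π) (v : H) : π 1 v = mu 1 1 • v := by
  obtain ⟨w, rfl⟩ := (hπ.2.1 1).2 v
  simpa using hπ.map_map 1 1 w

theorem inner_map_map_eq_mul (hπ : IsProjUnitaryRep mu π) (g h : G) (x a : H) :
    ⟪π g x, π h a⟫_ℂ = mu h (h⁻¹ * g) * ⟪π (h⁻¹ * g) x, a⟫_ℂ := by
  have h1 := hπ.map_map h (h⁻¹ * g) x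
  rw [mul_inv_cancel_left] at h1
  have h2 := hπ.inner_map_map h (π (h⁻¹ * g) x) a
  rw [h1, inner_smul_left] at h2
  rw [← h2, ← mul_assoc, Complex.mul_conj, Complex.normSq_eq_norm_sq, hπ.1]
  norm_num

theorem exists_inner_map_eq (hπ : IsProjUnitaryRep mu π) (g : G) :
    ∃ c : ℂ, ‖c‖ = 1 ∧ ∀ u v : H, ⟪π g u, v⟫_ℂ = c * ⟪u, π g⁻¹ v⟫_ℂ := by
  refine ⟨(mu g g⁻¹ * mu 1 1)⁻¹, by simp [hπ.1], fun u v => ?_⟩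
  have h1 := hπ.inner_map_map g u (π g⁻¹ v)
  rw [hπ.map_map, mul_inv_cancel, hπ.map_one, smul_smul, inner_smul_right] at h1
  have h2 : mu g g⁻¹ * mu 1 1 ≠ 0 := norm_ne_zero_iff.1 (by simp [hπ.1])
  rw [← h1, inv_mul_cancel_left₀ h2]

theorem norm_inner_map_eq (hπ : IsProjUnitaryRep mu π) (g : G) (u v : H) :
    ‖⟪u, π g v⟫_ℂ‖ = ‖⟪π g⁻¹ u, v⟫_ℂ‖ := by
  obtain ⟨c, hc, h⟩ := hπ.exists_inner_map_eq g⁻¹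
  rw [h, norm_mul, hc, one_mul, inv_inv]

end IsProjUnitaryRep

section Bessel

variable {G : Type*} {H : Type*} [NormedAddCommGroup H] [InnerProductSpace ℂ H]

/-- The Bessel vectors of `π` as a subspace. -/
def besselSubmodule (π : G → H →L[ℂ] H) : Submodule ℂ H where
  carrier := {ξ | IsBesselVector π ξ}
  zero_mem' := ⟨1, one_pos, fun x s => by simp⟩
  add_mem' := by
    rintro u v ⟨B, hB, hu⟩ ⟨C, hC, hv⟩
    refine ⟨2 * (B + C), by positivity, fun x s => ?_⟩
    calc ∑ g ∈ s, ‖⟪x, π g (u + v)⟫_ℂ‖ ^ 2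
        ≤ ∑ g ∈ s, (2 * ‖⟪x, π g u⟫_ℂ‖ ^ 2 + 2 * ‖⟪x, π g v⟫_ℂ‖ ^ 2) := by
          refine Finset.sum_le_sum fun g _ => ?_
          rw [_root_.map_add, inner_add_right, ← mul_add]
          exact (pow_le_pow_left₀ (norm_nonneg _) (norm_add_le _ _) 2).trans add_sq_le
      _ = 2 * ∑ g ∈ s, ‖⟪x, π g u⟫_ℂ‖ ^ 2 + 2 * ∑ g ∈ s, ‖⟪x, π g v⟫_ℂ‖ ^ 2 := by
          rw [Finset.sum_add_distrib, ← Finset.mul_sum, ← Finset.mul_sum]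
      _ ≤ 2 * (B + C) * ‖x‖ ^ 2 := by linarith [hu x s, hv x s]
  smul_mem' := by
    rintro r u ⟨B, hB, hu⟩
    refine ⟨(‖r‖ ^ 2 + 1) * B, by positivity, fun x s => ?_⟩
    simp only [map_smul, inner_smul_right, norm_mul, mul_pow, ← Finset.mul_sum]
    have h := hu x s
    have h0 : 0 ≤ B * ‖x‖ ^ 2 := by positivity
    nlinarith [mul_le_mul_of_nonneg_left h (sq_nonneg ‖r‖)]

/-- The range of the analysis operator of `x`, with coefficients linear in the analysed vector. -/
def analysisRange (π : G → H →L[ℂ] H) (x : H) : Set (lp (fun _ : G => ℂ) 2) :=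
  {F | ∃ a : H, ∀ g, F g = ⟪π g x, a⟫_ℂ}

/-- The graph of the analysis operator of `x`. -/
def analysisGraph (π : G → H →L[ℂ] H) (x : H) :
    Submodule ℂ (WithLp 2 (H × lp (fun _ : G => ℂ) 2)) where
  carrier := {p | ∀ g, p.snd g = ⟪π g x, p.fst⟫_ℂ}
  zero_mem' := fun g => by simp
  add_mem' := fun {p q} hp hq g => by simp [hp g, hq g]
  smul_mem' := fun r p hp g => by simp [hp g]

theorem isClosed_analysisGraph (π : G → H →L[ℂ] H) (x : H) :
    IsClosed (analysisGraph π x : Set (WithLp 2 (H × lp (fun _ : G => ℂ) 2))) := by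
  have h : (analysisGraph π x : Set (WithLp 2 (H × lp (fun _ : G => ℂ) 2))) =
      ⋂ g, {p | p.snd g = ⟪π g x, p.fst⟫_ℂ} := by
    ext p; simp only [Set.mem_iInter]; rfl
  rw [h]
  refine isClosed_iInter fun g => isClosed_eq ?_ ?_
  · exact ((lp.evalCLM ℂ (fun _ : G => ℂ) g (p := 2)).comp (WithLp.sndL 2 ℂ H _)).continuous
  · exact ((innerSL ℂ (π g x)).comp (WithLp.fstL 2 ℂ H _)).continuous

theorem setOf_analysis_eq_star_preimage (π : G → H →L[ℂ] H) (x : H) :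
    {F : lp (fun _ : G => ℂ) 2 |
        ∃ a : H, Summable (fun g : G => ‖⟪a, π g x⟫_ℂ‖ ^ 2) ∧ ∀ g : G, F g = ⟪a, π g x⟫_ℂ} =
      star ⁻¹' analysisRange π x := by
  ext F
  constructor
  · rintro ⟨a, -, h⟩
    exact ⟨a, fun g => by simp [h]⟩
  · rintro ⟨a, h⟩
    have h' (g : G) : F g = ⟪a, π g x⟫_ℂ := by
      rw [← inner_conj_symm, ← h]; simp
    refine ⟨a, ?_, h'⟩
    simpa [h'] using (memℓp_gen_iff (by norm_num)).1 (lp.memℓp F)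

/-- The subspace `π(G)'y`. -/
noncomputable def commutantOrbit (π : G → H →L[ℂ] H) (y : H) : Submodule ℂ H :=
  (Subalgebra.centralizer ℂ (Set.range π)).toSubmodule.map
    (ContinuousLinearMap.apply ℂ H y).toLinearMap

theorem span_image_commutant (π : G → H →L[ℂ] H) (y : H) :
    Submodule.span ℂ ((fun T : H →L[ℂ] H => T y) '' commutant (Set.range π)) =
      commutantOrbit π y :=
  (commutantOrbit π y).span_eq

theorem apply_mem_topologicalClosure_commutantOrbit {π : G → H →L[ℂ] H} {T : H →L[ℂ] H}
    (hT : T ∈ commutant (Set.range π)) {y v : H}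
    (hv : v ∈ (commutantOrbit π y).topologicalClosure) :
    T v ∈ (commutantOrbit π y).topologicalClosure := by
  refine map_mem_closure T.continuous hv ?_
  rintro _ ⟨S, hS, rfl⟩
  exact ⟨T * S, Set.mul_mem_centralizer hT hS, rfl⟩

theorem self_mem_commutantOrbit (π : G → H →L[ℂ] H) (y : H) : y ∈ commutantOrbit π y :=
  ⟨1, Set.one_mem_centralizer, rfl⟩

theorem topologicalClosure_commutantOrbit_le {π : G → H →L[ℂ] H} {x y : H}
    (hxy : x ∈ (commutantOrbit π y).topologicalClosure) :
    (commutantOrbit π x).topologicalClosure ≤ (commutantOrbit π y).topologicalClosure := by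
  refine Submodule.topologicalClosure_minimal _ ?_ (Submodule.isClosed_topologicalClosure _)
  rintro _ ⟨T, hT, rfl⟩
  exact apply_mem_topologicalClosure_commutantOrbit hT hxy

section Complete

variable [CompleteSpace H]

instance (x : H) : (analysisGraph π x).HasOrthogonalProjection :=
  haveI := (isClosed_analysisGraph π x).completeSpace_coe
  inferInstance

theorem norm_sq_starProjection_analysisGraph_le (π : G → H →L[ℂ] H) (x z : H) :
    ‖((analysisGraph π x).starProjection (WithLp.toLp 2 (z, 0))).fst‖ ^ 2 +
      ‖((analysisGraph π x).starProjection (WithLp.toLp 2 (z, 0))).snd‖ ^ 2 ≤ ‖z‖ ^ 2 := by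
  rw [← WithLp.prod_norm_sq_eq_of_L2]
  gcongr
  simpa using (analysisGraph π x).norm_starProjection_apply_le
    (WithLp.toLp 2 (z, (0 : lp (fun _ : G => ℂ) 2)))

end Complete

end Bessel

/-- For a Bessel vector `ξ`, the map `z ↦ (⟪π g ξ, z⟫)_g` is bounded into `ℓ²(G)`. -/
theorem IsBesselVector.exists_analysis {G : Type*} {H : Type*} [NormedAddCommGroup H]
    [InnerProductSpace ℂ H] {π : G → H →L[ℂ] H} {ξ : H} (hξ : IsBesselVector π ξ) :
    ∃ A : H →L[ℂ] lp (fun _ : G => ℂ) 2, ∀ z g, A z g = ⟪π g ξ, z⟫_ℂ := by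
  obtain ⟨B, -, hB⟩ := hξ
  refine exists_continuousLinearMap_lp_two (fun g => (innerSL ℂ (π g ξ)).toLinearMap) B
    fun z s => ?_
  simpa [norm_inner_symm] using hB z s


namespace IsProjUnitaryRep

variable {G : Type*} [Group G] {H : Type*} [NormedAddCommGroup H] [InnerProductSpace ℂ H]
  {mu : G → G → ℂ} {π : G → H →L[ℂ] H}

/-- For a Bessel vector `ξ`, the map `z ↦ (⟪π g z, ξ⟫)_g` is bounded into `ℓ²(G)`. -/
theorem exists_synthesis (hπ : IsProjUnitaryRep mu π) {ξ : H} (hξ : IsBesselVector π ξ) :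
    ∃ D : H →SL[starRingEnd ℂ] lp (fun _ : G => ℂ) 2, ∀ z g, D z g = ⟪π g z, ξ⟫_ℂ := by
  obtain ⟨B, -, hB⟩ := hξ
  refine exists_continuousLinearMap_lp_two
    (fun g => ((innerSLFlip ℂ ξ).comp (π g)).toLinearMap) B fun z s => ?_
  have h := hB z (s.map (Equiv.inv G).toEmbedding)
  rw [Finset.sum_map] at h
  refine (Finset.sum_le_sum fun g _ => ?_).trans h
  have := hπ.norm_inner_map_eq g⁻¹ z ξ
  rw [inv_inv] at this
  simp [this]

theorem inner_synthesis_eq_inner_analysis (hπ : IsProjUnitaryRep mu π) {η ξ z w : H}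
    {F F' K K' : lp (fun _ : G => ℂ) 2}
    (hF : ∀ g, F g = ⟪π g η, z⟫_ℂ) (hK : ∀ g, K g = ⟪π g ξ, w⟫_ℂ)
    (hF' : ∀ g, F' g = ⟪π g z, η⟫_ℂ) (hK' : ∀ g, K' g = ⟪π g w, ξ⟫_ℂ) :
    ⟪F', K'⟫_ℂ = ⟪K, F⟫_ℂ := by
  choose c hc h using hπ.exists_inner_map_eq
  rw [← inner_star_lp_two F K]
  refine inner_lp_two_reindex hc (Equiv.inv G) (fun g => ?_) fun g => ?_
  · simp [hF', hF, h g]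
  · simp [hK', hK, h g]

variable [CompleteSpace H]

/-- The projection onto the graph of an analysis operator is equivariant. -/
theorem exists_starProjection_analysisGraph_map (hπ : IsProjUnitaryRep mu π) (x z : H) (h : G) :
    ∃ F : lp (fun _ : G => ℂ) 2,
      (∀ g, F g = mu h (h⁻¹ * g) *
        ((analysisGraph π x).starProjection (WithLp.toLp 2 (z, 0))).snd (h⁻¹ * g)) ∧
      (analysisGraph π x).starProjection (WithLp.toLp 2 (π h z, 0)) =
        WithLp.toLp 2
          (π h ((analysisGraph π x).starProjection (WithLp.toLp 2 (z, 0))).fst, F) := by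
  set p := (analysisGraph π x).starProjection (WithLp.toLp 2 (z, 0)) with hp
  have hpm : p ∈ analysisGraph π x := Submodule.starProjection_apply_mem _ _
  have hmu : ∀ g, ‖mu h (h⁻¹ * g)‖ = 1 := fun g => hπ.1 _ _
  obtain ⟨F, hF⟩ := exists_lp_two_reindex (fun g => mu h (h⁻¹ * g)) hmu
    (Equiv.mulLeft h⁻¹) p.snd
  refine ⟨F, hF, Submodule.eq_starProjection_of_mem_of_inner_eq_zero ?_ ?_⟩
  · intro g
    have := hpm (h⁻¹ * g)
    simp [hF, this, hπ.inner_map_map_eq_mul]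
  · intro q hq
    obtain ⟨b, hb⟩ := (hπ.2.1 h).2 q.fst
    have hmu0 : ∀ g, mu h g ≠ 0 := fun g => norm_ne_zero_iff.1 (by simp [hπ.1])
    obtain ⟨K, hK⟩ := exists_lp_two_reindex (fun g => (mu h g)⁻¹) (by simp [hπ.1])
      (Equiv.mulLeft h) q.snd
    have hbK : WithLp.toLp 2 (b, K) ∈ analysisGraph π x := by
      intro g
      have := hq (h * g)
      simp [hK, this, ← hb, hπ.inner_map_map_eq_mul, hmu0]
    have h0 := Submodule.starProjection_inner_eq_zero (K := analysisGraph π x)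
      (WithLp.toLp 2 (z, 0)) _ hbK
    have hFK : ⟪F, q.snd⟫_ℂ = ⟪p.snd, K⟫_ℂ :=
      inner_lp_two_reindex hmu (Equiv.mulLeft h⁻¹) hF fun g => by simp [hK, hmu0]
    rw [← hp] at h0
    simp only [WithLp.prod_inner_apply, WithLp.ofLp_sub, Prod.fst_sub, Prod.snd_sub] at h0 ⊢
    simp only [inner_sub_left] at h0 ⊢
    simpa [← hb, hπ.inner_map_map, hFK] using h0

/-- Inner products with a rotated component of a projection onto the graph can be moved
to the projection of a vector of `H`. -/
theorem exists_inner_fst_starProjection_eq (hπ : IsProjUnitaryRep mu π) (x z : H) (g : G)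
    (q : WithLp 2 (H × lp (fun _ : G => ℂ) 2)) :
    ∃ F : lp (fun _ : G => ℂ) 2,
      (∀ k, ‖F k‖ = ‖((analysisGraph π x).starProjection (WithLp.toLp 2 (z, 0))).snd (g * k)‖) ∧
      ⟪π g⁻¹ z, ((analysisGraph π x).starProjection q).fst⟫_ℂ =
        ⟪π g⁻¹ ((analysisGraph π x).starProjection (WithLp.toLp 2 (z, 0))).fst, q.fst⟫_ℂ +
          ⟪F, q.snd⟫_ℂ := by
  obtain ⟨F, hF, hP⟩ := hπ.exists_starProjection_analysisGraph_map x z g⁻¹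
  refine ⟨F, fun k => by simp [hF, hπ.1], ?_⟩
  have := Submodule.inner_starProjection_left_eq_right (analysisGraph π x)
    (WithLp.toLp 2 (π g⁻¹ z, 0)) q
  rw [hP] at this
  simpa [WithLp.prod_inner_apply] using this.symm

theorem isBesselVector_fst_starProjection (hπ : IsProjUnitaryRep mu π) (x ξ : H)
    (hξ : IsBesselVector π ξ) :
    IsBesselVector π ((analysisGraph π x).starProjection (WithLp.toLp 2 (ξ, 0))).fst := by
  obtain ⟨B, hB, hξ⟩ := hξ
  refine ⟨B, hB, fun z s => ?_⟩
  have key (g : G) : ‖⟪z, π g ((analysisGraph π x).starProjection (WithLp.toLp 2 (ξ, 0))).fst⟫_ℂ‖ =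
      ‖⟪((analysisGraph π x).starProjection (WithLp.toLp 2 (z, 0))).fst, π g ξ⟫_ℂ‖ := by
    obtain ⟨F, -, h⟩ := hπ.exists_inner_fst_starProjection_eq x z g (WithLp.toLp 2 (ξ, 0))
    rw [hπ.norm_inner_map_eq, h, hπ.norm_inner_map_eq]
    simp
  simp only [key]
  refine (hξ _ s).trans (mul_le_mul_of_nonneg_left ?_ hB.le)
  nlinarith [norm_sq_starProjection_analysisGraph_le π x z]

theorem isBesselVector_fst_starProjection_single [DecidableEq G] (hπ : IsProjUnitaryRep mu π)
    (x : H) (k : G) (c : ℂ) :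
    IsBesselVector π
      ((analysisGraph π x).starProjection (WithLp.toLp 2 (0, lp.single 2 k c))).fst := by
  refine ⟨‖c‖ ^ 2 + 1, by positivity, fun z s => ?_⟩
  have key (g : G) : ‖⟪z, π g ((analysisGraph π x).starProjection
        (WithLp.toLp 2 (0, lp.single 2 k c))).fst⟫_ℂ‖ =
      ‖c‖ * ‖((analysisGraph π x).starProjection (WithLp.toLp 2 (z, 0))).snd
        (Equiv.mulRight k g)‖ := by
    obtain ⟨F, hF, h⟩ :=
      hπ.exists_inner_fst_starProjection_eq x z g (WithLp.toLp 2 (0, lp.single 2 k c))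
    rw [hπ.norm_inner_map_eq, h, Equiv.coe_mulRight, ← hF]
    simp [lp.inner_single_right]
  simp only [key, mul_pow, ← Finset.mul_sum]
  have h := sum_norm_sq_le_lp_two
    ((analysisGraph π x).starProjection (WithLp.toLp 2 (z, 0))).snd
    (s.map (Equiv.mulRight k).toEmbedding)
  rw [Finset.sum_map] at h
  have h' := norm_sq_starProjection_analysisGraph_le π x z
  simp only [Equiv.coe_toEmbedding] at h
  gcongr
  · linarith
  · nlinarith

/-- The Bessel vectors form a core for every analysis operator. -/
theorem analysisRange_subset_closure_bessel (hπ : IsProjUnitaryRep mu π)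
    (hdense : Dense {y : H | IsBesselVector π y}) (x : H) :
    analysisRange π x ⊆ closure {F : lp (fun _ : G => ℂ) 2 |
      ∃ ξ : H, IsBesselVector π ξ ∧ ∀ g, F g = ⟪π g x, ξ⟫_ℂ} := by
  classical
  set P := (analysisGraph π x).starProjection
  let V : Submodule ℂ (WithLp 2 (H × lp (fun _ : G => ℂ) 2)) :=
    (besselSubmodule π).comap ((WithLp.fstL 2 ℂ H _).comp P : _ →L[ℂ] H).toLinearMap
  have hfst (a : H) : WithLp.toLp 2 (a, (0 : lp (fun _ : G => ℂ) 2)) ∈ closure (V : Set _) := by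
    refine map_mem_closure (f := fun a => WithLp.toLp 2 (a, (0 : lp (fun _ : G => ℂ) 2)))
      (by fun_prop) (hdense a) fun ξ hξ => ?_
    exact hπ.isBesselVector_fst_starProjection x ξ hξ
  have hsnd (F : lp (fun _ : G => ℂ) 2) : WithLp.toLp 2 ((0 : H), F) ∈ closure (V : Set _) := by
    refine map_mem_closure (f := fun F => WithLp.toLp 2 ((0 : H), F))
      (s := Set.range fun s : Finset G => ∑ k ∈ s, lp.single 2 k (F k)) (by fun_prop)
      (mem_closure_of_tendsto (lp.hasSum_single (by norm_num) F)
        (Filter.Eventually.of_forall fun s => ⟨s, rfl⟩)) ?_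
    rintro _ ⟨s, rfl⟩
    have : WithLp.toLp 2 ((0 : H), ∑ k ∈ s, lp.single 2 k (F k)) =
        ∑ k ∈ s, WithLp.toLp 2 ((0 : H), lp.single (E := fun _ : G => ℂ) 2 k (F k)) := by
      induction s using Finset.induction_on with
      | empty => simp
      | insert k s hk ih =>
        rw [Finset.sum_insert hk, Finset.sum_insert hk, ← ih, ← WithLp.toLp_add]
        simp
    change WithLp.toLp 2 ((0 : H), ∑ k ∈ s, lp.single 2 k (F k)) ∈ V
    rw [this]
    exact V.sum_mem fun k _ => hπ.isBesselVector_fst_starProjection_single x k _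
  rintro F ⟨a, ha⟩
  have hmem : WithLp.toLp 2 (a, F) ∈ V.topologicalClosure := by
    have := V.topologicalClosure.add_mem (hfst a) (hsnd F)
    rwa [← WithLp.toLp_add, Prod.mk_add_mk, add_zero, zero_add] at this
  have hgraph : WithLp.toLp 2 (a, F) ∈ analysisGraph π x := ha
  have hF : F = (P (WithLp.toLp 2 (a, F))).snd := by
    have hP : P (WithLp.toLp 2 (a, F)) = WithLp.toLp 2 (a, F) :=
      (analysisGraph π x).starProjection_eq_self_iff.2 hgraph
    exact congrArg WithLp.snd hP.symm
  rw [hF]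
  refine map_mem_closure (f := fun p => (P p).snd)
    ((WithLp.sndL 2 ℂ H _).comp P).continuous hmem fun p hp => ?_
  exact ⟨(P p).fst, hp, (analysisGraph π x).starProjection_apply_mem p⟩

/-- If `x` lies in `[π(G)'y]`, then the range of the analysis operator of `x` lies in the
closure of that of `y`. -/
theorem analysisRange_subset_closure (hπ : IsProjUnitaryRep mu π)
    (hdense : Dense {y : H | IsBesselVector π y}) {x y : H}
    (hxy : x ∈ (commutantOrbit π y).topologicalClosure) :
    analysisRange π x ⊆ closure (analysisRange π y) := by
  refine (hπ.analysisRange_subset_closure_bessel hdense x).trans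
    (closure_minimal ?_ isClosed_closure)
  rintro F ⟨ξ, hξ, hF⟩
  obtain ⟨D, hD⟩ := hπ.exists_synthesis hξ
  obtain rfl : F = D x := lp.ext (funext fun g => by rw [hF, hD])
  refine map_mem_closure D.continuous hxy ?_
  rintro _ ⟨T, hT, rfl⟩
  refine ⟨ContinuousLinearMap.adjoint T ξ, fun g => ?_⟩
  have := congrArg (fun S : H →L[ℂ] H => S y) (hT (π g) ⟨g, rfl⟩)
  simp only [mul_apply_eq_comp] at this
  rw [hD, ContinuousLinearMap.adjoint_inner_right, ← this]
  rfl

/-- For Bessel vectors `η` and `ξ` with analysis maps `A` and `A'`, the operator `A† A'` lies in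
the commutant of `π`. -/
theorem adjoint_comp_mem_commutant (hπ : IsProjUnitaryRep mu π) {η ξ : H}
    {A A' : H →L[ℂ] lp (fun _ : G => ℂ) 2} (hA : ∀ z g, A z g = ⟪π g η, z⟫_ℂ)
    (hA' : ∀ z g, A' z g = ⟪π g ξ, z⟫_ℂ) :
    (ContinuousLinearMap.adjoint A).comp A' ∈ commutant (Set.range π) := by
  rintro _ ⟨h, rfl⟩
  ext u
  refine ext_inner_left ℂ fun w => ?_
  obtain ⟨v, rfl⟩ := (hπ.2.1 h).2 w
  simp only [mul_apply_eq_comp, ContinuousLinearMap.comp_apply, hπ.inner_map_map,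
    ContinuousLinearMap.adjoint_inner_right]
  refine (inner_lp_two_reindex (c := fun g => mu h (h⁻¹ * g)) (fun g => hπ.1 _ _)
    (Equiv.mulLeft h⁻¹) (fun g => ?_) fun g => ?_).symm
  · simp [hA, hπ.inner_map_map_eq_mul]
  · simp [hA', hπ.inner_map_map_eq_mul]

/-- If the range of the analysis operator of `x` lies in the closure of that of `y`, then `x`
lies in `[π(G)'y]`. -/
theorem mem_topologicalClosure_commutantOrbit (hπ : IsProjUnitaryRep mu π)
    (hdense : Dense {y : H | IsBesselVector π y}) {x y : H}
    (hxy : analysisRange π x ⊆ closure (analysisRange π y)) :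
    x ∈ (commutantOrbit π y).topologicalClosure := by
  set M := (commutantOrbit π y).topologicalClosure
  set z := x - M.starProjection x
  have hzM : ∀ v ∈ M, ⟪z, v⟫_ℂ = 0 := M.starProjection_inner_eq_zero x
  have hortho : ∀ η, IsBesselVector π η → ∀ F : lp (fun _ : G => ℂ) 2,
      (∀ g, F g = ⟪π g z, η⟫_ℂ) → ∀ K ∈ analysisRange π x, ⟪F, K⟫_ℂ = 0 := by
    intro η hη F hF K hK
    have hclosed : IsClosed {K : lp (fun _ : G => ℂ) 2 | ⟪F, K⟫_ℂ = 0} :=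
      isClosed_eq (innerSL ℂ F).continuous continuous_const
    refine closure_minimal ?_ hclosed (closure_minimal
      (hπ.analysisRange_subset_closure_bessel hdense y) isClosed_closure (hxy hK))
    rintro K' ⟨ξ, hξ, hK'⟩
    obtain ⟨A, hA⟩ := hη.exists_analysis
    obtain ⟨A', hA'⟩ := hξ.exists_analysis
    have h0 := hzM _ (apply_mem_topologicalClosure_commutantOrbit
      (hπ.adjoint_comp_mem_commutant hA hA')
      (subset_closure (self_mem_commutantOrbit π y)))
    rw [ContinuousLinearMap.comp_apply, ContinuousLinearMap.adjoint_inner_right] at h0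
    change ⟪F, K'⟫_ℂ = 0
    rw [hπ.inner_synthesis_eq_inner_analysis (hA z) (hA' y) hF hK', ← inner_conj_symm, h0,
      map_zero]
  have hbessel : ∀ η ∈ {y : H | IsBesselVector π y}, ⟪z, η⟫_ℂ = 0 := by
    intro η hη
    obtain ⟨A, hA⟩ := hη.exists_analysis
    obtain ⟨D, hD⟩ := hπ.exists_synthesis hη
    have h1 : ⟪A x, A z⟫_ℂ = 0 := by
      rw [← hπ.inner_synthesis_eq_inner_analysis (hA z) (hA x) (hD z) (hD x)]
      exact hortho η hη _ (hD z) _ ⟨η, hD x⟩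
    have h2 : ⟪A z, A (M.starProjection x)⟫_ℂ = 0 := by
      rw [← ContinuousLinearMap.adjoint_inner_right]
      exact hzM _ (apply_mem_topologicalClosure_commutantOrbit
        (hπ.adjoint_comp_mem_commutant hA hA) (M.starProjection_apply_mem x))
    have h3 : A z = 0 := by
      have hAz : A z = A x - A (M.starProjection x) := map_sub _ _ _
      rw [← inner_self_eq_zero (𝕜 := ℂ)]
      nth_rewrite 2 [hAz]
      rw [inner_sub_right, h2, ← inner_conj_symm, h1]
      simp
    have h4 : ⟪π 1 η, z⟫_ℂ = 0 := by rw [← hA, h3]; rfl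
    rw [hπ.map_one, inner_smul_left, mul_eq_zero, map_eq_zero] at h4
    rw [← inner_conj_symm, h4.resolve_left (norm_ne_zero_iff.1 (by simp [hπ.1])), map_zero]
  have hz0 : z = 0 := hdense.eq_zero_of_inner_left ℂ fun v hv => hbessel v hv
  rw [← M.starProjection_eq_self_iff]
  exact (sub_eq_zero.1 hz0).symm

theorem closure_analysisRange_eq_iff (hπ : IsProjUnitaryRep mu π)
    (hdense : Dense {y : H | IsBesselVector π y}) (x y : H) :
    closure (analysisRange π x) = closure (analysisRange π y) ↔
      (commutantOrbit π x).topologicalClosure = (commutantOrbit π y).topologicalClosure := by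
  constructor
  · intro h
    exact le_antisymm
      (topologicalClosure_commutantOrbit_le <|
        hπ.mem_topologicalClosure_commutantOrbit hdense (h ▸ subset_closure))
      (topologicalClosure_commutantOrbit_le <|
        hπ.mem_topologicalClosure_commutantOrbit hdense (h ▸ subset_closure))
  · intro h
    have hx := (commutantOrbit π x).le_topologicalClosure (self_mem_commutantOrbit π x)
    have hy := (commutantOrbit π y).le_topologicalClosure (self_mem_commutantOrbit π y)
    exact Set.Subset.antisymm
      (closure_minimal (hπ.analysisRange_subset_closure hdense (h ▸ hx)) isClosed_closure)
      (closure_minimal (hπ.analysisRange_subset_closure hdense (h ▸ hy)) isClosed_closure)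

end IsProjUnitaryRep

/-- **Characterization of `π`-weak equivalence.** For a projective unitary representation
`π` of a countable group `G` on a complex separable Hilbert space `H` with dense Bessel
vectors, the closures of the ranges of the analysis operators `Θ_x` and `Θ_y` in `ℓ²(G)`
coincide iff the closed linear spans `[π(G)'x]` and `[π(G)'y]` coincide. -/
theorem piWeaklyEquivalent_iff_commutant_span
    {G : Type*} [Group G] [Countable G]
    {H : Type*} [NormedAddCommGroup H] [InnerProductSpace ℂ H] [CompleteSpace H]
    [TopologicalSpace.SeparableSpace H]
    (mu : G → G → ℂ) (π : G → H →L[ℂ] H) (hπ : IsProjUnitaryRep mu π)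
    (hdense : Dense {y : H | IsBesselVector π y}) (x y : H) :
    closure {F : lp (fun _ : G => ℂ) 2 |
        ∃ a : H, Summable (fun g : G => ‖⟪a, π g x⟫_ℂ‖ ^ 2) ∧ ∀ g : G, F g = ⟪a, π g x⟫_ℂ} =
      closure {F : lp (fun _ : G => ℂ) 2 |
        ∃ a : H, Summable (fun g : G => ‖⟪a, π g y⟫_ℂ‖ ^ 2) ∧ ∀ g : G, F g = ⟪a, π g y⟫_ℂ}
    ↔ closure (Submodule.span ℂ ((fun T : H →L[ℂ] H => T x) '' commutant (Set.range π)) : Set H) =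
      closure (Submodule.span ℂ ((fun T : H →L[ℂ] H => T y) '' commutant (Set.range π)) : Set H) := by
  have hstar : ∀ s : Set (lp (fun _ : G => ℂ) 2), closure (star ⁻¹' s) = star ⁻¹' closure s :=
    fun s => ((Homeomorph.mk (Equiv.mk star star star_star star_star)
      continuous_star continuous_star).preimage_closure s).symm
  rw [setOf_analysis_eq_star_preimage, setOf_analysis_eq_star_preimage, hstar, hstar,
    (Function.Involutive.surjective star_star).preimage_injective.eq_iff,
    hπ.closure_analysisRange_eq_iff hdense, span_image_commutant, span_image_commutant,
    ← SetLike.coe_set_eq]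
  rfl
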